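/- Let G be a finite connected simple graph on at least two vertices. If the second largest distance eigenvalue of G satisfies λ2(G) < −1/2, then G is a Ptolemaic graph, i.e., for all vertices u, v, w, x of G one has d_G(u,v)·d_G(w,x) ≤ d_G(u,w)·d_G(v,x) + d_G(u,x)·d_G(v,w). -/

import Mathlib

open Polynomial SimpleGraph Sum

noncomputable section

/-- The distance matrix of a graph, with real entries. -/
def distMatrix {V : Type*} [Fintype V] (G : SimpleGraph V) : Matrix V V ℝ :=
  Matrix.of fun u v => (G.dist u v : ℝ)

/-- The second largest distance eigenvalue: the eigenvalues of the distance matrix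
(the roots of its characteristic polynomial, with multiplicity) are sorted in
increasing order, and we take the one at position `card V - 2`. -/
def lambda2 {V : Type*} [Fintype V] [DecidableEq V] (G : SimpleGraph V) : ℝ :=
  ((distMatrix G).charpoly.roots.sort (· ≤ ·)).getD (Fintype.card V - 2) 0

/-- The diameter of a finite graph. -/
def graphDiam {V : Type*} [Fintype V] (G : SimpleGraph V) : ℕ :=
  Finset.univ.sup fun p : V × V => G.dist p.1 p.2

/-- A graph is chordal if every cycle of length at least 4 has a chord. -/
def IsChordal {V : Type*} (G : SimpleGraph V) : Prop :=
  ∀ (v : V) (c : G.Walk v v), c.IsCycle → 4 ≤ c.length →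
    ∃ u w : V, u ∈ c.support ∧ w ∈ c.support ∧ G.Adj u w ∧ s(u, w) ∉ c.edges

/-- Ptolemaic graph: the Ptolemy inequality for the graph distance. -/
def IsPtolemaic {V : Type*} (G : SimpleGraph V) : Prop :=
  ∀ u v w x : V,
    G.dist u v * G.dist w x ≤ G.dist u w * G.dist v x + G.dist u x * G.dist v w

/-- `S` is a `uv`-separator: `u, v ∉ S` and every walk from `u` to `v` meets `S`. -/
def IsUVSeparator {V : Type*} (G : SimpleGraph V) (S : Finset V) (u v : V) : Prop :=
  u ∉ S ∧ v ∉ S ∧ ∀ w : G.Walk u v, ∃ x ∈ w.support, x ∈ S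

/-- `S` is a minimal vertex separator: a minimal `uv`-separator for some pair of
distinct non-adjacent vertices `u, v`. -/
def IsMinimalVertexSeparator {V : Type*} (G : SimpleGraph V) (S : Finset V) : Prop :=
  ∃ u v : V, u ≠ v ∧ ¬ G.Adj u v ∧ IsUVSeparator G S u v ∧
    ∀ T : Finset V, T ⊂ S → ¬ IsUVSeparator G T u v

/-- A connected component `K` of `G − S` is full if every vertex of `S` has a
neighbour in `K`. -/
def IsFullComponent {V : Type*} (G : SimpleGraph V) (S : Finset V)
    (K : (G.induce ((S : Set V)ᶜ)).ConnectedComponent) : Prop :=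
  ∀ a ∈ S, ∃ x : ((S : Set V)ᶜ : Set V),
    (G.induce ((S : Set V)ᶜ)).connectedComponentMk x = K ∧ G.Adj a ↑x

/-- The join `G ⊕ H` of two vertex-disjoint graphs. -/
def graphJoin {α β : Type*} (G : SimpleGraph α) (H : SimpleGraph β) :
    SimpleGraph (α ⊕ β) :=
  SimpleGraph.fromRel fun x y =>
    (∃ a b, x = Sum.inl a ∧ y = Sum.inl b ∧ G.Adj a b) ∨
    (∃ a b, x = Sum.inr a ∧ y = Sum.inr b ∧ H.Adj a b) ∨
    (x.isLeft ∧ y.isRight)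

/-- The disjoint union of two vertex-disjoint graphs. -/
def graphSum {α β : Type*} (G : SimpleGraph α) (H : SimpleGraph β) :
    SimpleGraph (α ⊕ β) :=
  SimpleGraph.fromRel fun x y =>
    (∃ a b, x = Sum.inl a ∧ y = Sum.inl b ∧ G.Adj a b) ∨
    (∃ a b, x = Sum.inr a ∧ y = Sum.inr b ∧ H.Adj a b)

/-- `p` disjoint copies of the complete graph `K_r`. -/
def cliqueCopies (p r : ℕ) : SimpleGraph (Fin p × Fin r) :=
  SimpleGraph.fromRel fun x y => x.1 = y.1

/-- `q` disjoint copies of `K_1 ⊕ (K_1 ∪ K_2)` (the paw graph): in each copy,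
vertex 0 is universal, vertex 1 is otherwise isolated, vertices 2,3 form a `K_2`. -/
def pawCopies (q : ℕ) : SimpleGraph (Fin q × Fin 4) :=
  SimpleGraph.fromRel fun x y => x.1 = y.1 ∧ (x.2 = 0 ∨ (x.2 = 2 ∧ y.2 = 3))

/-- `s` disjoint copies of the path `P_3`. -/
def path3Copies (s : ℕ) : SimpleGraph (Fin s × Fin 3) :=
  SimpleGraph.fromRel fun x y => x.1 = y.1 ∧ ((x.2 = 0 ∧ y.2 = 1) ∨ (x.2 = 1 ∧ y.2 = 2))

/-- The disjoint union `p_1 K_{r_1} ∪ ⋯ ∪ p_k K_{r_k}`. -/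
def multiCliques (k : ℕ) (p r : Fin k → ℕ) :
    SimpleGraph ((i : Fin k) × (Fin (p i) × Fin (r i))) :=
  SimpleGraph.fromRel fun x y =>
    (⟨x.1, x.2.1⟩ : (i : Fin k) × Fin (p i)) = ⟨y.1, y.2.1⟩

/-- The relaxed block star
`K_1 ⊕ ((p_1 K_{r_1} ∪ ⋯ ∪ p_k K_{r_k}) ∪ q (K_1 ⊕ (K_1 ∪ K_2)) ∪ s P_3)`. -/
def relaxedBlockStar (k : ℕ) (p r : Fin k → ℕ) (q s : ℕ) :
    SimpleGraph (Unit ⊕ (((i : Fin k) × (Fin (p i) × Fin (r i))) ⊕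
      ((Fin q × Fin 4) ⊕ (Fin s × Fin 3)))) :=
  graphJoin (⊤ : SimpleGraph Unit)
    (graphSum (multiCliques k p r) (graphSum (pawCopies q) (path3Copies s)))

/-- The graph `G(r,p,q) = K_1 ⊕ (p K_r ∪ q (K_1 ⊕ (K_1 ∪ K_2)))`. -/
def Grpq (r p q : ℕ) : SimpleGraph (Unit ⊕ ((Fin p × Fin r) ⊕ (Fin q × Fin 4))) :=
  graphJoin (⊤ : SimpleGraph Unit) (graphSum (cliqueCopies p r) (pawCopies q))

/-- The full house graph `K_2 ⊕ (K_1 ∪ K_2)`: vertices 0,1 form the join-`K_2`,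
vertex 2 is the `K_1`, vertices 3,4 form the `K_2`. -/
def fullHouse : SimpleGraph (Fin 5) :=
  SimpleGraph.fromRel fun x y => x = 0 ∨ x = 1 ∨ (x = 3 ∧ y = 4)

/-- The diamond graph: `K_4` minus an edge. -/
def diamondGraph : SimpleGraph (Fin 4) :=
  SimpleGraph.fromRel fun x y => x = 0 ∨ x = 1

/-- The path on four vertices. -/
def path4 : SimpleGraph (Fin 4) :=
  SimpleGraph.fromRel fun x y => (x : ℕ) + 1 = (y : ℕ)

/-- The cycle on four vertices. -/
def cycle4 : SimpleGraph (Fin 4) :=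
  SimpleGraph.fromRel fun x y => x + 1 = y

/-- The triple block graph `Pt_2(p,q)`: a full house (on `Fin 5`, with the
join-`K_2` being vertices `a = 0`, `b = 1`) together with `p - 1` further vertices
forming with `a` a clique `K_p` and `q - 1` further vertices forming with `b`
a clique `K_q`. -/
def Pt2Graph (p q : ℕ) : SimpleGraph (Fin 5 ⊕ (Fin (p - 1) ⊕ Fin (q - 1))) :=
  SimpleGraph.fromRel fun x y =>
    match x, y with
    | Sum.inl a, Sum.inl b => a = 0 ∨ a = 1 ∨ (a = 3 ∧ b = 4)
    | Sum.inl a, Sum.inr (Sum.inl _) => a = 0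
    | Sum.inl a, Sum.inr (Sum.inr _) => a = 1
    | Sum.inr (Sum.inl _), Sum.inr (Sum.inl _) => True
    | Sum.inr (Sum.inr _), Sum.inr (Sum.inr _) => True
    | _, _ => False

/-- The nine-vertex graph `Pt_1`: a full house (vertices 0,…,4, join-`K_2` being
`a = 0`, `b = 1`, `K_2` being 3,4), a vertex 5 adjacent only to `a`, a vertex 6
adjacent only to `b`, and vertices 7,8 adjacent to each other and to `b`. -/
def Pt1Graph : SimpleGraph (Fin 9) :=
  SimpleGraph.fromRel fun x y =>
    (x = 0 ∧ (y = 1 ∨ y = 2 ∨ y = 3 ∨ y = 4 ∨ y = 5)) ∨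
    (x = 1 ∧ (y = 2 ∨ y = 3 ∨ y = 4 ∨ y = 6 ∨ y = 7 ∨ y = 8)) ∨
    (x = 3 ∧ y = 4) ∨ (x = 7 ∧ y = 8)

/-- `G` contains an induced subgraph isomorphic to `H`. -/
def HasInducedSubgraph {V W : Type*} (G : SimpleGraph V) (H : SimpleGraph W) : Prop :=
  ∃ s : Set V, Nonempty ((G.induce s) ≃g H)

/-- `G` is isomorphic to a connected induced subgraph of `H`. -/
def IsoToConnectedInducedSubgraph {V W : Type*} (G : SimpleGraph V)
    (H : SimpleGraph W) : Prop :=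
  ∃ s : Set W, (H.induce s).Connected ∧ Nonempty (G ≃g (H.induce s))

/-- A vertex is simplicial if its neighbourhood is a clique. -/
def IsSimplicial {V : Type*} (G : SimpleGraph V) (v : V) : Prop :=
  G.IsClique (G.neighborSet v)

/-- The quintic polynomial `f(r,p,q,x)`. -/
def fpoly (r p q : ℕ) : Polynomial ℝ :=
  X ^ 5 - C (8 * (q : ℝ) + 2 * (r : ℝ) * (p : ℝ) - (r : ℝ) - 8) * X ^ 4
    - C ((8 * (r : ℝ) + 36) * (q : ℝ) + 15 * (r : ℝ) * (p : ℝ) - 7 * (r : ℝ) - 20) * X ^ 3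
    - C ((28 * (r : ℝ) + 52) * (q : ℝ) + 33 * (r : ℝ) * (p : ℝ) - 13 * (r : ℝ) - 18) * X ^ 2
    - C ((24 * (r : ℝ) + 30) * (q : ℝ) + 23 * (r : ℝ) * (p : ℝ) - 5 * (r : ℝ) - 5) * X
    - C ((6 * (r : ℝ) + 6) * (q : ℝ) + 5 * (r : ℝ) * (p : ℝ))

end


theorem Matrix.IsHermitian.dotProduct_mulVec_eq_sum {V : Type*} [Fintype V] [DecidableEq V]
    {A : Matrix V V ℝ} (hA : A.IsHermitian) (z : V → ℝ) :
    z ⬝ᵥ A.mulVec z =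
      ∑ i, hA.eigenvalues i * ((hA.eigenvectorBasis i).ofLp ⬝ᵥ z) ^ 2 := by
  have hsymm (i : V) : (hA.eigenvectorBasis i).ofLp ⬝ᵥ A.mulVec z =
      hA.eigenvalues i * ((hA.eigenvectorBasis i).ofLp ⬝ᵥ z) := by
    have hT : A.IsSymm := by simpa using hA
    rw [Matrix.dotProduct_mulVec, ← Matrix.mulVec_transpose, hT.eq, hA.mulVec_eigenvectorBasis]
    simp
  have h := hA.eigenvectorBasis.sum_inner_mul_inner (WithLp.toLp 2 z)
    (WithLp.toLp 2 (A.mulVec z))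
  simp only [EuclideanSpace.inner_eq_star_dotProduct, star_trivial] at h
  rw [dotProduct_comm, ← h]
  refine Finset.sum_congr rfl fun i _ => ?_
  rw [dotProduct_comm (A.mulVec z), hsymm]
  ring

theorem Matrix.IsHermitian.dotProduct_self_eq_sum {V : Type*} [Fintype V] [DecidableEq V]
    {A : Matrix V V ℝ} (hA : A.IsHermitian) (z : V → ℝ) :
    z ⬝ᵥ z = ∑ i, ((hA.eigenvectorBasis i).ofLp ⬝ᵥ z) ^ 2 := by
  have h := hA.eigenvectorBasis.sum_inner_mul_inner (WithLp.toLp 2 z) (WithLp.toLp 2 z)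
  simp only [EuclideanSpace.inner_eq_star_dotProduct, star_trivial] at h
  rw [← h]
  refine Finset.sum_congr rfl fun i _ => ?_
  rw [dotProduct_comm z]
  ring

/-- In an increasing list of length `n` whose entry at position `n - 2` is less than `c`,
at most one entry is at least `c`. -/
theorem List.countP_le_one_of_getD_lt {l : List ℝ} (hl : l.Pairwise (· ≤ ·))
    (hlen : 2 ≤ l.length) {c : ℝ} (h : l.getD (l.length - 2) 0 < c) :
    l.countP (fun r => decide (c ≤ r)) ≤ 1 := by
  rw [List.getD_eq_getElem _ _ (by omega)] at h
  rw [← List.take_append_drop (l.length - 1) l, List.countP_append]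
  have h1 : (l.take (l.length - 1)).countP (fun r => decide (c ≤ r)) = 0 := by
    rw [List.countP_eq_zero]
    intro r hr
    obtain ⟨i, hi, rfl⟩ := List.mem_take_iff_getElem.1 hr
    have : l[i] ≤ l[l.length - 2] := by
      rcases (show i ≤ l.length - 2 by omega).eq_or_lt with h' | h'
      · simp [h']
      · exact List.pairwise_iff_getElem.1 hl _ _ _ _ h'
    simpa using this.trans_lt h
  have h2 := List.countP_le_length (l := l.drop (l.length - 1)) (p := fun r => decide (c ≤ r))
  rw [List.length_drop] at h2
  omega

theorem distMatrix_isHermitian {V : Type*} [Fintype V] (G : SimpleGraph V) :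
    (distMatrix G).IsHermitian := by
  ext u v
  simp [distMatrix, G.dist_comm]

theorem exists_eigenvalues_lt_of_lambda2_lt {V : Type*} [Fintype V] [DecidableEq V]
    {G : SimpleGraph V} (hcard : 2 ≤ Fintype.card V) {c : ℝ} (h : lambda2 G < c) :
    ∃ i₀, ∀ i, i ≠ i₀ → (distMatrix_isHermitian G).eigenvalues i < c := by
  set hA := distMatrix_isHermitian G
  have hroots : (distMatrix G).charpoly.roots = Multiset.map hA.eigenvalues Finset.univ.val := by
    simpa using hA.roots_charpoly_eq_eigenvalues
  have hlen : ((distMatrix G).charpoly.roots.sort (· ≤ ·)).length = Fintype.card V := by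
    simp [hroots]
  have hcount := List.countP_le_one_of_getD_lt
    (Multiset.pairwise_sort (distMatrix G).charpoly.roots (· ≤ ·)) (c := c)
    (by omega) (by rwa [hlen])
  rw [← Multiset.coe_countP, Multiset.sort_eq, hroots, Multiset.countP_map] at hcount
  have hle : (Finset.univ.filter fun i => c ≤ hA.eigenvalues i).card ≤ 1 := by
    simpa [Finset.card_def] using hcount
  rw [Finset.card_le_one] at hle
  by_cases hex : ∃ i, c ≤ hA.eigenvalues i
  · obtain ⟨i₀, hi₀⟩ := hex
    refine ⟨i₀, fun i hi => lt_of_not_ge fun hci => hi ?_⟩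
    exact hle i (by simpa using hci) i₀ (by simpa using hi₀)
  · push Not at hex
    obtain ⟨i₀⟩ : Nonempty V := Fintype.card_pos_iff.1 (by omega)
    exact ⟨i₀, fun i _ => hex i⟩

/-- If `λ₂ < -1/2`, the quadratic form of `D + I/2` is negative on the orthogonal complement
(with respect to this form) of a vector on which it is positive. -/
theorem neg_of_lambda2_lt {V : Type*} [Fintype V] [DecidableEq V]
    {G : SimpleGraph V} (hcard : 2 ≤ Fintype.card V) (hlam : lambda2 G < -1/2)
    {x y : V → ℝ} (hx : x ≠ 0)
    (hyy : 0 < y ⬝ᵥ (distMatrix G).mulVec y + 1/2 * (y ⬝ᵥ y))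
    (hxy : x ⬝ᵥ (distMatrix G).mulVec y + 1/2 * (x ⬝ᵥ y) = 0) :
    x ⬝ᵥ (distMatrix G).mulVec x + 1/2 * (x ⬝ᵥ x) < 0 := by
  obtain ⟨i₀, hi₀⟩ := exists_eigenvalues_lt_of_lambda2_lt hcard hlam
  have hA := distMatrix_isHermitian G
  set e := (hA.eigenvectorBasis i₀).ofLp with he
  have hneg (z : V → ℝ) (hz : z ≠ 0) (hez : e ⬝ᵥ z = 0) :
      z ⬝ᵥ (distMatrix G).mulVec z + 1/2 * (z ⬝ᵥ z) < 0 := by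
    have hpos : 0 < z ⬝ᵥ z := by
      simpa using Matrix.dotProduct_star_self_pos_iff.2 hz
    rw [hA.dotProduct_self_eq_sum] at hpos
    obtain ⟨j, -, hj⟩ := Finset.exists_lt_of_sum_lt (f := fun _ => (0 : ℝ)) (by simpa using hpos)
    rw [hA.dotProduct_self_eq_sum, hA.dotProduct_mulVec_eq_sum, Finset.mul_sum,
      ← Finset.sum_add_distrib]
    simp only [← add_mul]
    refine Finset.sum_neg' (fun i _ => ?_) ⟨j, Finset.mem_univ _, ?_⟩
    · by_cases hi : i = i₀
      · subst hi
        rw [← he, hez]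
        simp
      · exact mul_nonpos_of_nonpos_of_nonneg (by linarith [hi₀ i hi]) (sq_nonneg _)
    · have hji : j ≠ i₀ := by
        rintro rfl
        rw [← he, hez] at hj
        simp at hj
      exact mul_neg_of_neg_of_pos (by linarith [hi₀ j hji]) hj
  have hy : y ≠ 0 := by
    rintro rfl
    simp at hyy
  have hey : e ⬝ᵥ y ≠ 0 := fun h => (hneg y hy h).not_gt hyy
  have hyx : y ⬝ᵥ (distMatrix G).mulVec x = x ⬝ᵥ (distMatrix G).mulVec y := by
    have hT : (distMatrix G).IsSymm := by simpa using hA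
    rw [Matrix.dotProduct_mulVec, ← Matrix.mulVec_transpose, hT.eq, dotProduct_comm]
  set t := (e ⬝ᵥ x) / (e ⬝ᵥ y)
  have hez : e ⬝ᵥ (x - t • y) = 0 := by
    simp [t, div_mul_cancel₀ _ hey]
  have hexpand : (x - t • y) ⬝ᵥ (distMatrix G).mulVec (x - t • y)
      + 1/2 * ((x - t • y) ⬝ᵥ (x - t • y)) =
      (x ⬝ᵥ (distMatrix G).mulVec x + 1/2 * (x ⬝ᵥ x))
        + t ^ 2 * (y ⬝ᵥ (distMatrix G).mulVec y + 1/2 * (y ⬝ᵥ y)) := by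
    simp only [Matrix.mulVec_sub, Matrix.mulVec_smul, dotProduct_sub, sub_dotProduct,
      smul_dotProduct, dotProduct_smul, smul_eq_mul, hyx, dotProduct_comm y x]
    linear_combination (-2 * t) * hxy
  have hz : x - t • y ≠ 0 := by
    intro h
    rw [sub_eq_zero] at h
    rw [h, smul_dotProduct, smul_dotProduct, smul_eq_mul, smul_eq_mul] at hxy
    have ht : t = 0 := by
      rcases mul_eq_zero.1 (show t * (y ⬝ᵥ (distMatrix G).mulVec y + 1/2 * (y ⬝ᵥ y)) = 0 by
        linarith) with h' | h'
      · exact h'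
      · exact absurd h' hyy.ne'
    exact hx (by rw [h, ht, zero_smul])
  have := hneg _ hz hez
  rw [hexpand] at this
  nlinarith [mul_nonneg (sq_nonneg t) hyy.le]

/-- Two geodesics `b, a, …, c` and `a, …, c, d` that overlap in at least one edge glue to a
geodesic from `b` to `d`. -/
theorem dist_eq_add_two_of_overlap {V : Type*} [Fintype V] [DecidableEq V]
    {G : SimpleGraph V} (hcard : 2 ≤ Fintype.card V) (hconn : G.Connected)
    (hlam : lambda2 G < -1/2) {a b c d : V} (hab : G.dist a b = 1) (hcd : G.dist c d = 1)
    (hac : G.dist a c ≠ 0) (hbc : G.dist b c = G.dist a c + 1)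
    (had : G.dist a d = G.dist a c + 1) : G.dist b d = G.dist a c + 2 := by
  have hab' : a ≠ b := by rintro rfl; simp at hab
  have hcd' : c ≠ d := by rintro rfl; simp at hcd
  have hac' : a ≠ c := by rintro rfl; simp at hac
  have hbc' : b ≠ c := by rintro rfl; simp at hbc
  have had' : a ≠ d := by rintro rfl; simp at had
  have hbd' : b ≠ d := by rintro rfl; omega
  have hupper : G.dist b d ≤ G.dist a c + 2 := by
    have := hconn.dist_triangle (u := b) (v := c) (w := d)
    omega
  by_contra hne
  have hle : (G.dist b d : ℝ) ≤ G.dist a c + 1 := by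
    exact_mod_cast (show G.dist b d ≤ G.dist a c + 1 by omega)
  have hbcR : (G.dist b c : ℝ) = G.dist a c + 1 := by exact_mod_cast hbc
  have hadR : (G.dist a d : ℝ) = G.dist a c + 1 := by exact_mod_cast had
  have hacR : (0 : ℝ) ≤ G.dist a c := Nat.cast_nonneg _
  have key := neg_of_lambda2_lt hcard hlam
    (x := Pi.single a 1 - Pi.single b 1 - Pi.single c 1 + Pi.single d 1)
    (y := Pi.single a 1 + Pi.single c 1) ?_ ?_ ?_
  · simp [Matrix.mulVec_add, Matrix.mulVec_sub, distMatrix, hab', hcd', hac', hbc', had', hbd',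
      hab'.symm, hcd'.symm, hac'.symm, hbc'.symm, had'.symm, hbd'.symm,
      G.dist_comm (u := b) (v := a), G.dist_comm (u := c) (v := a),
      G.dist_comm (u := d) (v := a), G.dist_comm (u := c) (v := b),
      G.dist_comm (u := d) (v := b), G.dist_comm (u := d) (v := c), hab, hcd, hbcR, hadR] at key
    linarith
  · intro h
    simpa [Pi.single_apply, hab', hac', had', hab'.symm, hac'.symm, had'.symm] using congrFun h a
  · simp [Matrix.mulVec_add, distMatrix, hac', hac'.symm,
      G.dist_comm (u := c) (v := a)]
    linarith
  · simp [Matrix.mulVec_add, distMatrix, hab', hcd', hac', had', hac'.symm, hbc'.symm,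
      G.dist_comm (u := b) (v := a), G.dist_comm (u := c) (v := a),
      G.dist_comm (u := d) (v := a),
      G.dist_comm (u := d) (v := c), hab, hcd, hbcR, hadR]
    ring

theorem SimpleGraph.Connected.exists_dist_eq_one_and_dist_eq {V : Type*} {G : SimpleGraph V}
    (hconn : G.Connected) {u v : V} {n : ℕ} (h : G.dist u v = n + 1) :
    ∃ w, G.dist u w = 1 ∧ G.dist w v = n := by
  obtain ⟨p, hp⟩ := hconn.exists_walk_length_eq_dist u v
  cases p with
  | nil => simp at h
  | @cons _ w _ hadj q =>
    have h1 := SimpleGraph.dist_eq_one_iff_adj.2 hadj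
    have h2 := SimpleGraph.dist_le q
    have h3 := hconn.dist_triangle (u := u) (v := w) (w := v)
    rw [SimpleGraph.Walk.length_cons] at hp
    exact ⟨w, h1, by omega⟩

/-- Distances that increase along the first edge of a geodesic `a, b, c` increase along the
second one. -/
def DistIncreasing {V : Type*} (G : SimpleGraph V) : Prop :=
  ∀ u a b c : V, G.dist a b = 1 → G.dist b c = 1 → G.dist a c = 2 →
    G.dist u b = G.dist u a + 1 → G.dist u c = G.dist u a + 2

theorem distIncreasing_of_lambda2_lt {V : Type*} [Fintype V] [DecidableEq V]
    {G : SimpleGraph V} (hcard : 2 ≤ Fintype.card V) (hconn : G.Connected)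
    (hlam : lambda2 G < -1/2) : DistIncreasing G := by
  intro u a b c hab hbc hac
  induction hm : G.dist u a generalizing u with
  | zero =>
    obtain rfl := hconn.dist_eq_zero_iff.1 hm
    exact fun _ => by simpa using hac
  | succ m ih =>
    intro hub
    obtain ⟨w, huw, hwa⟩ := hconn.exists_dist_eq_one_and_dist_eq hm
    have h1 := hconn.dist_triangle (u := w) (v := a) (w := b)
    have h2 := hconn.dist_triangle (u := u) (v := w) (w := b)
    have hwb : G.dist w b = m + 1 := by omega
    have hwc := ih w hwa hwb
    have := dist_eq_add_two_of_overlap hcard hconn hlam (a := b) (b := c) (c := w) (d := u) hbc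
      (by rw [G.dist_comm, huw]) (by rw [G.dist_comm]; omega)
      (by rw [G.dist_comm, hwc, G.dist_comm, hwb])
      (by rw [G.dist_comm, hub, G.dist_comm, hwb])
    rw [G.dist_comm, this, G.dist_comm, hwb]

namespace DistIncreasing

variable {V : Type*} {G : SimpleGraph V}

theorem dist_eq_one_of_level (hG : DistIncreasing G) (hconn : G.Connected) {u v w p : V}
    (hvw : G.dist v w = 1) (hlevel : G.dist u v = G.dist u w) (hpv : G.dist p v = 1)
    (hup : G.dist u v = G.dist u p + 1) : G.dist p w = 1 := by
  have h1 := hconn.dist_triangle (u := p) (v := v) (w := w)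
  have h2 : G.dist p w ≠ 0 := by
    intro h
    obtain rfl := hconn.dist_eq_zero_iff.1 h
    omega
  by_contra h3
  have := hG u p v w hpv hvw (by omega) hup
  omega

/-- If `u` and `v` are both equidistant from the first two vertices of a geodesic `a, b, c` and
`v` is equidistant from all three, then `u` and `v` have distance less than the sum of their
distances to `b`. -/
theorem dist_lt_of_level (hG : DistIncreasing G) (hconn : G.Connected) {u v a b c : V}
    (hab : G.dist a b = 1) (hbc : G.dist b c = 1) (hac : G.dist a c = 2)
    (hua : G.dist u a = G.dist u b) (hva : G.dist v a = G.dist v b)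
    (hvc : G.dist v c = G.dist v b) : G.dist u v < G.dist u b + G.dist v b := by
  have exists_lower (x : V) (hx : G.dist x a = G.dist x b) :
      ∃ s, G.dist s a = 1 ∧ G.dist s b = 1 ∧ G.dist x b = G.dist x s + 1 := by
    obtain ⟨k, hk⟩ : ∃ k, G.dist x a = k + 1 := by
      refine Nat.exists_eq_succ_of_ne_zero fun h => ?_
      obtain rfl := hconn.dist_eq_zero_iff.1 h
      omega
    rw [G.dist_comm] at hk
    obtain ⟨s, has, hsx⟩ := hconn.exists_dist_eq_one_and_dist_eq hk
    rw [G.dist_comm] at has hsx hk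
    exact ⟨s, has, hG.dist_eq_one_of_level hconn hab hx has (by omega), by omega⟩
  obtain ⟨s, hsa, hsb, hus⟩ := exists_lower u hua
  obtain ⟨t, hta, htb, hvt⟩ := exists_lower v hva
  have htc := hG.dist_eq_one_of_level hconn hbc hvc.symm htb hvt
  have h1 := hconn.dist_triangle (u := s) (v := a) (w := t)
  have h2 := hconn.dist_triangle (u := s) (v := b) (w := c)
  have h3 := hconn.dist_triangle (u := u) (v := s) (w := v)
  have h4 := hconn.dist_triangle (u := s) (v := t) (w := v)
  rw [G.dist_comm (u := a)] at h1
  rw [G.dist_comm (u := t) (v := v)] at h4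
  by_cases hst : G.dist s t = 2
  · have := hG s a t c (by rw [G.dist_comm, hta]) htc hac (by omega)
    omega
  · omega

/-- No vertex is equidistant from four consecutive vertices of a geodesic. -/
theorem not_level_four (hG : DistIncreasing G) (hconn : G.Connected) {u a b c d : V}
    (hab : G.dist a b = 1) (hbc : G.dist b c = 1) (hcd : G.dist c d = 1) (had : G.dist a d = 3)
    (hb : G.dist u b = G.dist u a) (hc : G.dist u c = G.dist u a)
    (hd : G.dist u d = G.dist u a) : False := by
  obtain ⟨k, hk⟩ : ∃ k, G.dist a u = k + 1 := by
    refine Nat.exists_eq_succ_of_ne_zero fun h => ?_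
    obtain rfl := hconn.dist_eq_zero_iff.1 h
    simp_all
  obtain ⟨s, has, hsu⟩ := hconn.exists_dist_eq_one_and_dist_eq hk
  rw [G.dist_comm] at hsu hk
  have hsa : G.dist s a = 1 := by rw [G.dist_comm, has]
  have hsb := hG.dist_eq_one_of_level hconn hab hb.symm hsa (by omega)
  have hsc := hG.dist_eq_one_of_level (u := u) hconn hbc (by omega) hsb (by omega)
  have hsd := hG.dist_eq_one_of_level (u := u) hconn hcd (by omega) hsc (by omega)
  have := hconn.dist_triangle (u := a) (v := s) (w := d)
  omega

end DistIncreasing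

theorem SimpleGraph.Connected.exists_geodesic {V : Type*} {G : SimpleGraph V}
    (hconn : G.Connected) (w x : V) :
    ∃ γ : ℕ → V, γ 0 = w ∧ γ (G.dist w x) = x ∧
      ∀ i j, i ≤ j → j ≤ G.dist w x → G.dist (γ i) (γ j) = j - i := by
  obtain ⟨p, hp⟩ := hconn.exists_walk_length_eq_dist w x
  refine ⟨p.getVert, p.getVert_zero, by rw [← hp, p.getVert_length], fun i j hij hj => ?_⟩
  have h1 : G.dist w (p.getVert i) ≤ i :=
    (SimpleGraph.dist_le (p.take i)).trans (by simp)
  have h2 : G.dist (p.getVert j) x ≤ p.length - j :=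
    (SimpleGraph.dist_le (p.drop j)).trans (by simp)
  have h3 : G.dist (p.getVert i) (p.getVert j) ≤ j - i := by
    have hend : (p.drop i).getVert (j - i) = p.getVert j := by
      rw [SimpleGraph.Walk.drop_getVert, show i + (j - i) = j by omega]
    exact (SimpleGraph.dist_le (((p.drop i).take (j - i)).copy rfl hend)).trans (by simp)
  have h4 := hconn.dist_triangle (u := w) (v := p.getVert i) (w := x)
  have h5 := hconn.dist_triangle (u := p.getVert i) (v := p.getVert j) (w := x)
  omega

/-- Along a geodesic, the distance to a fixed vertex decreases `p` times, then stays constant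
at most twice, then increases. -/
theorem DistIncreasing.exists_profile {V : Type*} {G : SimpleGraph V} (hG : DistIncreasing G)
    (hconn : G.Connected) (u : V) (γ : ℕ → V) (n : ℕ)
    (hγ : ∀ i j, i ≤ j → j ≤ n → G.dist (γ i) (γ j) = j - i) :
    ∃ p j q h, p + j + q = n ∧ j ≤ 2 ∧
      (∀ i ≤ p, G.dist u (γ i) + i = h + p) ∧
      (∀ i, p ≤ i → i ≤ p + j → G.dist u (γ i) = h) ∧
      (∀ i, p + j ≤ i → i ≤ n → G.dist u (γ i) + p + j = h + i) := by
  induction n with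
  | zero =>
    exact ⟨0, 0, 0, G.dist u (γ 0), rfl, by omega, by intro i hi; simp_all,
      by intro i _ hi; simp_all, by intro i _ hi; simp_all⟩
  | succ n ih =>
    obtain ⟨p, j, q, h, hn, hj, hdec, hlev, hinc⟩ := ih fun i j hij hjn => hγ i j hij (by omega)
    have hstep := hγ n (n + 1) (by omega) le_rfl
    have t1 := hconn.dist_triangle (u := u) (v := γ n) (w := γ (n + 1))
    have t2 := hconn.dist_triangle (u := u) (v := γ (n + 1)) (w := γ n)
    rw [G.dist_comm (u := γ (n + 1))] at t2
    have hlast := hinc n (by omega) le_rfl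
    have up (i : ℕ) (hi : i + 2 ≤ n + 1) (h' : G.dist u (γ (i + 1)) = G.dist u (γ i) + 1) :
        G.dist u (γ (i + 2)) = G.dist u (γ i) + 2 :=
      hG u _ _ _ (by rw [hγ _ _ (by omega) (by omega)]; omega)
        (by rw [hγ _ _ (by omega) (by omega)]; omega)
        (by rw [hγ _ _ (by omega) (by omega)]; omega) h'
    have down (i : ℕ) (hi : i + 2 ≤ n + 1)
        (h' : G.dist u (γ (i + 1)) = G.dist u (γ (i + 2)) + 1) :
        G.dist u (γ i) = G.dist u (γ (i + 2)) + 2 :=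
      hG u _ _ _ (by rw [G.dist_comm, hγ _ _ (by omega) (by omega)]; omega)
        (by rw [G.dist_comm, hγ _ _ (by omega) (by omega)]; omega)
        (by rw [G.dist_comm, hγ _ _ (by omega) (by omega)]; omega) h'
    obtain hs | hs | hs : G.dist u (γ (n + 1)) = G.dist u (γ n) + 1 ∨
        G.dist u (γ (n + 1)) = G.dist u (γ n) ∨ G.dist u (γ (n + 1)) + 1 = G.dist u (γ n) := by
      omega
    · refine ⟨p, j, q + 1, h, by omega, hj, hdec, hlev, fun i h1 h2 => ?_⟩
      rcases h2.eq_or_lt with rfl | h2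
      · omega
      · exact hinc i h1 (by omega)
    · have hq : q = 0 := by
        by_contra hq
        obtain ⟨m, rfl⟩ : ∃ m, n = m + 1 := ⟨n - 1, by omega⟩
        have := hinc m (by omega) (by omega)
        have : G.dist u (γ (m + 1 + 1)) = _ := up m (by omega) (by omega)
        omega
      have hj' : j ≠ 2 := by
        rintro rfl
        obtain ⟨m, rfl⟩ : ∃ m, n = m + 2 := ⟨n - 2, by omega⟩
        have h0 := hlev m (by omega) (by omega)
        have h1 := hlev (m + 1) (by omega) (by omega)
        have h2 := hlev (m + 2) (by omega) (by omega)
        exact hG.not_level_four hconn (u := u) (a := γ m) (b := γ (m + 1)) (c := γ (m + 2))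
          (d := γ (m + 3)) (by rw [hγ _ _ (by omega) (by omega)]; omega)
          (by rw [hγ _ _ (by omega) (by omega)]; omega)
          (by rw [hγ _ _ (by omega) (by omega)]; omega)
          (by rw [hγ _ _ (by omega) (by omega)]; omega)
          (by omega) (by omega) (by rw [hs]; omega)
      refine ⟨p, j + 1, 0, h, by omega, by omega, hdec, fun i h1 h2 => ?_, fun i h1 h2 => ?_⟩
      · by_cases hi : i = n + 1
        · subst hi; omega
        · exact hlev i h1 (by omega)
      · obtain rfl : i = n + 1 := by omega
        omega
    · have hjq : j = 0 ∧ q = 0 := by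
        by_contra hjq
        obtain ⟨m, rfl⟩ : ∃ m, n = m + 1 := ⟨n - 1, by omega⟩
        change G.dist u (γ (m + 2)) + 1 = G.dist u (γ (m + 1)) at hs
        have hd := down m (by omega) hs.symm
        by_cases hq : q = 0
        · have := hlev m (by omega) (by omega)
          have := hlev (m + 1) (by omega) (by omega)
          omega
        · have := hinc m (by omega) (by omega)
          omega
      obtain ⟨rfl, rfl⟩ := hjq
      have hdec' : ∀ i ≤ p + 1, G.dist u (γ i) + i = h - 1 + (p + 1) := by
        intro i hi
        rcases hi.eq_or_lt with rfl | hi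
        · rw [show p + 1 = n + 1 by omega]
          omega
        · have := hdec i (by omega)
          omega
      refine ⟨p + 1, 0, 0, h - 1, by omega, by omega, hdec', fun i h1 h2 => ?_, fun i h1 h2 => ?_⟩
      · have := hdec' i (by omega)
        omega
      · have := hdec' i (by omega)
        omega

theorem mul_le_of_separated_profiles {d n p j q h p' j' q' h' : ℕ} (hn : n = p + j + q)
    (hn' : n = p' + j' + q') (hj : j ≤ 2) (hj' : j' ≤ 2) (hh : j = 0 ∨ 1 ≤ h)
    (hh' : j' = 0 ∨ 1 ≤ h') (hsep : p + j ≤ p') (hd : d + p + j ≤ h + h' + p') :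
    d * n ≤ (h + p) * (h' + q') + (h + q) * (h' + p') := by
  obtain ⟨m, rfl⟩ := Nat.exists_eq_add_of_le hsep
  obtain rfl : q = m + j' + q' := by omega
  have hdn : d * n ≤ (h + h' + m) * n := Nat.mul_le_mul_right _ (by omega)
  refine hdn.trans ?_
  subst hn
  rcases hh with rfl | hh <;> rcases hh' with rfl | hh'
  · nlinarith
  · nlinarith
  · nlinarith
  · have : 0 ≤ (2 * (h : ℤ) - j) * (2 * (h' : ℤ) - j') := mul_nonneg (by omega) (by omega)
    zify
    nlinarith [mul_nonneg (Int.natCast_nonneg p) (Int.natCast_nonneg q'),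
      mul_nonneg (Int.natCast_nonneg p) (Int.natCast_nonneg j'),
      mul_nonneg (Int.natCast_nonneg j) (Int.natCast_nonneg q'),
      mul_nonneg (Int.natCast_nonneg j) (Int.natCast_nonneg j')]

theorem mul_le_of_overlapping_profiles {d n p j q h p' j' q' h' : ℕ} (hn : n = p + j + q)
    (hn' : n = p' + j' + q') (hj : j ≤ 2) (hj' : j' ≤ 2) (hh : j = 0 ∨ 1 ≤ h)
    (hh' : j' = 0 ∨ 1 ≤ h') (hd : d + 1 ≤ h + h' ∨ j * j' ≤ 1 ∧ d ≤ h + h') :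
    d * n ≤ (h + p) * (h' + q') + (h + q) * (h' + p') := by
  zify at *
  have h1 : 0 ≤ (2 * (h : ℤ) - j) * (2 * (h' : ℤ) - j') := mul_nonneg (by omega) (by omega)
  have h2 : (0 : ℤ) ≤ p * q' := by positivity
  have h3 : (0 : ℤ) ≤ q * p' := by positivity
  have expand : ((h : ℤ) + p) * (h' + q') + (h + q) * (h' + p') =
      (h + h') * n + (2 * h * h' - h * j' - h' * j) + p * q' + q * p' := by
    linear_combination (-h') * hn - h * hn'
  rw [expand]
  rcases hd with hd | ⟨hjj, hd⟩
  · have h4 : (d : ℤ) * n ≤ (h + h' - 1) * n := mul_le_mul_of_nonneg_right (by omega) (by omega)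
    have h5 : (j : ℤ) * j' ≤ 2 * n := by nlinarith
    linarith
  · have h4 : (d : ℤ) * n ≤ (h + h') * n := mul_le_mul_of_nonneg_right hd (by omega)
    have h5 : -1 ≤ 2 * (2 * (h : ℤ) * h' - h * j' - h' * j) := by linarith
    have h6 : 0 ≤ 2 * (h : ℤ) * h' - h * j' - h' * j := by omega
    linarith

theorem DistIncreasing.isPtolemaic {V : Type*} {G : SimpleGraph V} (hG : DistIncreasing G)
    (hconn : G.Connected) : IsPtolemaic G := by
  intro u v w x
  obtain ⟨γ, hγ0, hγn, hγ⟩ := hconn.exists_geodesic w x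
  obtain ⟨p, j, q, h, hn, hj, hdec, hlev, hinc⟩ := hG.exists_profile hconn u γ _ hγ
  obtain ⟨p', j', q', h', hn', hj', hdec', hlev', hinc'⟩ := hG.exists_profile hconn v γ _ hγ
  have pos {y : V} {p j h : ℕ} (hpj : p + j ≤ G.dist w x)
      (hl : ∀ i, p ≤ i → i ≤ p + j → G.dist y (γ i) = h) (hj : j ≠ 0) : 1 ≤ h := by
    by_contra hh
    have h1 := hconn.dist_eq_zero_iff.1 ((hl p le_rfl (by omega)).trans (by omega))
    have h2 := hconn.dist_eq_zero_iff.1 ((hl (p + 1) (by omega) (by omega)).trans (by omega))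
    have := hγ p (p + 1) (by omega) (by omega)
    rw [← h1, ← h2, SimpleGraph.dist_self] at this
    omega
  have hh : j = 0 ∨ 1 ≤ h := or_iff_not_imp_left.2 (pos (by omega) hlev)
  have hh' : j' = 0 ∨ 1 ≤ h' := or_iff_not_imp_left.2 (pos (by omega) hlev')
  have huw := hdec 0 (by omega)
  have hux := hinc _ (by omega) le_rfl
  have hvw := hdec' 0 (by omega)
  have hvx := hinc' _ (by omega) le_rfl
  rw [hγ0] at huw hvw
  rw [hγn] at hux hvx
  have tri (i : ℕ) : G.dist u v ≤ G.dist u (γ i) + G.dist v (γ i) := by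
    have := hconn.dist_triangle (u := u) (v := γ i) (w := v)
    rwa [G.dist_comm (u := γ i)] at this
  have hux' : G.dist u x = h + q := by omega
  have hvx' : G.dist v x = h' + q' := by omega
  rw [show G.dist u w = h + p by omega, show G.dist v w = h' + p' by omega, hux', hvx']
  rcases le_or_gt (p + j) p' with hcase | hcase
  · exact mul_le_of_separated_profiles hn.symm hn'.symm hj hj' hh hh' hcase
      (by
        have := tri p'
        have := hlev' p' le_rfl (by omega)
        have := hinc p' (by omega) (by omega)
        omega)
  rcases le_or_gt (p' + j') p with hcase' | hcase'
  · have := mul_le_of_separated_profiles (d := G.dist u v) hn'.symm hn.symm hj' hj hh' hh hcase'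
      (by
        have := tri p
        have := hlev p le_rfl (by omega)
        have := hinc' p (by omega) (by omega)
        omega)
    linarith
  have hedge : G.dist u v + 1 ≤ h + h' ∨ j * j' ≤ 1 ∧ G.dist u v ≤ h + h' := by
    have consec (i k : ℕ) (hi : i ≤ G.dist w x) (hk : k ≤ G.dist w x) :
        G.dist (γ i) (γ k) = (k - i) + (i - k) := by
      rcases le_total i k with hik | hik
      · rw [hγ i k hik hk]; omega
      · rw [G.dist_comm, hγ k i hik hi]; omega
    have close {a b c : ℕ} (ha : a ≤ G.dist w x) (hb : b ≤ G.dist w x) (hc : c ≤ G.dist w x)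
        (hab : (b - a) + (a - b) = 1) (hbc : (c - b) + (b - c) = 1)
        (hac : (c - a) + (a - c) = 2) (hua : G.dist u (γ a) = h) (hub : G.dist u (γ b) = h)
        (hva : G.dist v (γ a) = h') (hvb : G.dist v (γ b) = h')
        (huvc : G.dist u (γ c) = h ∨ G.dist v (γ c) = h') : G.dist u v + 1 ≤ h + h' := by
      rw [← consec _ _ ha hb] at hab
      rw [← consec _ _ hb hc] at hbc
      rw [← consec _ _ ha hc] at hac
      rcases huvc with huc | hvc
      · have := hG.dist_lt_of_level hconn hab hbc hac (hva.trans hvb.symm) (hua.trans hub.symm)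
          (huc.trans hub.symm)
        rw [G.dist_comm] at this
        omega
      · have := hG.dist_lt_of_level hconn hab hbc hac (hua.trans hub.symm) (hva.trans hvb.symm)
          (hvc.trans hvb.symm)
        omega
    obtain ⟨i, hpi, hpi', hi⟩ : ∃ i, p ≤ i ∧ p' ≤ i ∧ (i = p ∨ i = p') :=
      ⟨max p p', le_max_left .., le_max_right .., max_choice ..⟩
    have hu0 := hlev i (by omega) (by omega)
    have hv0 := hlev' i (by omega) (by omega)
    have hi' := tri i
    rcases Nat.eq_zero_or_pos j with rfl | hjpos
    · exact .inr ⟨by simp, by omega⟩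
    rcases Nat.eq_zero_or_pos j' with rfl | hjpos'
    · exact .inr ⟨by simp, by omega⟩
    have hu1 := hlev (i + 1) (by omega) (by omega)
    have hv1 := hlev' (i + 1) (by omega) (by omega)
    by_cases hnext : i + 2 ≤ p + j ∨ i + 2 ≤ p' + j'
    · exact .inl <| close (a := i) (b := i + 1) (c := i + 2) (by omega) (by omega) (by omega)
        (by omega) (by omega) (by omega) hu0 hu1 hv0 hv1
        (hnext.imp (hlev _ (by omega)) (hlev' _ (by omega)))
    by_cases hprev : p + 1 ≤ i ∨ p' + 1 ≤ i
    · exact .inl <| close (a := i + 1) (b := i) (c := i - 1) (by omega) (by omega) (by omega)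
        (by omega) (by omega) (by omega) hu1 hu0 hv1 hv0
        (hprev.imp (fun _ => hlev _ (by omega) (by omega))
          fun _ => hlev' _ (by omega) (by omega))
    · obtain rfl : j = 1 := by omega
      obtain rfl : j' = 1 := by omega
      exact .inr ⟨le_rfl, by omega⟩
  exact mul_le_of_overlapping_profiles hn.symm hn'.symm hj hj' hh hh' hedge

/-- A connected graph with second largest distance eigenvalue less than `-1/2`
is Ptolemaic. -/
theorem stmt_2 {V : Type*} [Fintype V] [DecidableEq V] (G : SimpleGraph V)
    (hcard : 2 ≤ Fintype.card V) (hconn : G.Connected)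
    (hlam : lambda2 G < -1/2) :
    ∀ u v w x : V,
      G.dist u v * G.dist w x ≤ G.dist u w * G.dist v x + G.dist u x * G.dist v w :=
  (distIncreasing_of_lambda2_lt hcard hconn hlam).isPtolemaic hconn
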